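/- arXiv:2202.00420 — 2 statements merged into one kernel-verified Lean document; each statement's English description precedes it below -/
import Mathlib

section
/- Assume there exists a saddle point for the normal problem: a pair (x̃, ṽ) ∈ X × X with −A*Aṽ − ∇F(x̃) ∈ ∂R(x̃) and A*Ax̃ = A*b. Let (x_k, y_k) be generated by the scalar exact primal–dual algorithm with data b, initialization y₀ = y₋₁ + σ(Ax₀ − b), and stepsize condition 1 − τ(L + σ‖A‖²) ≥ 0. Then there exists x̃_∞ minimizing R + F over {x ∈ X : A*Ax = A*b} such that the averaged primal iterates x̂_k = (1/k)∑_{j=1}^k x_j converge weakly to x̃_∞. Moreover, if the problem min{R(x) + F(x) : Ax = b} has no solution, then ‖ŷ_k‖ → +∞, where ŷ_k = (1/k)∑_{j=1}^k y_j. -/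
open scoped RealInnerProductSpace ENNReal NNReal
open Filter Topology

noncomputable section

/-- The `ε`-subdifferential of an extended-real-valued function `R` at `x`:
`∂_ε R (x) = {u : ∀ x', R x - R x' ≤ ⟪u, x - x'⟫ + ε}`, written without `EReal` subtraction. -/
def epsSubdiff {X : Type*} [NormedAddCommGroup X] [InnerProductSpace ℝ X]
    (R : X → EReal) (ε : ℝ) (x : X) : Set X :=
  {u | ∀ x' : X, R x + ((⟪u, x' - x⟫ - ε : ℝ) : EReal) ≤ R x'}

/-- Convexity for extended-real-valued functions. -/
def ERealConvex {X : Type*} [AddCommGroup X] [Module ℝ X] (R : X → EReal) : Prop :=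
  ∀ x y : X, ∀ t : ℝ, 0 ≤ t → t ≤ 1 →
    R (t • x + (1 - t) • y) ≤ (t : EReal) * R x + ((1 - t : ℝ) : EReal) * R y

/-- `R` is proper, convex and lower semicontinuous. -/
def ProperConvexLsc {X : Type*} [NormedAddCommGroup X] [InnerProductSpace ℝ X]
    (R : X → EReal) : Prop :=
  (∃ x, R x ≠ ⊤) ∧ (∀ x, R x ≠ ⊥) ∧ ERealConvex R ∧ LowerSemicontinuous R

/-- The Lagrangian `L_b(x,y) = R x + F x + ⟪y, A x - b⟫`. -/
def Lag {X Y : Type*} [NormedAddCommGroup X] [InnerProductSpace ℝ X]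
    [NormedAddCommGroup Y] [InnerProductSpace ℝ Y]
    (R : X → EReal) (F : X → ℝ) (A : X →L[ℝ] Y) (b : Y) (x : X) (y : Y) : EReal :=
  R x + ((F x + ⟪y, A x - b⟫ : ℝ) : EReal)

/-- Saddle points of the Lagrangian `L_b`. -/
def IsSaddle {X Y : Type*} [NormedAddCommGroup X] [InnerProductSpace ℝ X]
    [NormedAddCommGroup Y] [InnerProductSpace ℝ Y]
    (R : X → EReal) (F : X → ℝ) (A : X →L[ℝ] Y) (b : Y) (p : X × Y) : Prop :=
  ∀ x : X, ∀ y : Y, Lag R F A b p.1 y ≤ Lag R F A b x p.2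

/-- Weak convergence of a sequence in a Hilbert space. -/
def WeakTendsto {X : Type*} [NormedAddCommGroup X] [InnerProductSpace ℝ X]
    (u : ℕ → X) (l : X) : Prop :=
  ∀ w : X, Tendsto (fun k => ⟪u k, w⟫) atTop (nhds ⟪l, w⟫)

/-- `V(x,y) = ½‖x‖_T² + ½‖y‖_Σ²`, written via the inverses of the preconditioners. -/
def Vfun {X Y : Type*} [NormedAddCommGroup X] [InnerProductSpace ℝ X]
    [NormedAddCommGroup Y] [InnerProductSpace ℝ Y]
    (Tinv : X →L[ℝ] X) (Sginv : Y →L[ℝ] Y) (z : X × Y) : ℝ :=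
  1 / 2 * ⟪Tinv z.1, z.1⟫ + 1 / 2 * ⟪Sginv z.2, z.2⟫

variable {X Y : Type*}
  [NormedAddCommGroup X] [InnerProductSpace ℝ X] [CompleteSpace X]
  [NormedAddCommGroup Y] [InnerProductSpace ℝ Y] [CompleteSpace Y]

/-- `p` is the proximal point `prox_{τR}(w)`, i.e. a minimizer of
`u ↦ R u + (1/(2τ))‖u - w‖²`. -/
def IsProx {X : Type*} [NormedAddCommGroup X] [InnerProductSpace ℝ X]
    (R : X → EReal) (τ : ℝ) (w p : X) : Prop :=
  ∀ u : X, R p + ((1 / (2 * τ) * ‖p - w‖ ^ 2 : ℝ) : EReal)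
    ≤ R u + ((1 / (2 * τ) * ‖u - w‖ ^ 2 : ℝ) : EReal)

section ConvexAnalysis

variable {X : Type*} [NormedAddCommGroup X] [InnerProductSpace ℝ X]

/-- A closed convex set contains the weak limits of its points along any nontrivial filter. -/
theorem Convex.mem_of_tendsto_weak {E ι : Type*} [NormedAddCommGroup E] [NormedSpace ℝ E]
    {C : Set E} (hC : Convex ℝ C) (hC' : IsClosed C) {l : Filter ι} [l.NeBot]
    {u : ι → E} {a : E} (hu : ∀ᶠ i in l, u i ∈ C)
    (ha : ∀ f : StrongDual ℝ E, Tendsto (fun i => f (u i)) l (𝓝 (f a))) : a ∈ C := by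
  by_contra h
  obtain ⟨f, s, hs, hf⟩ := geometric_hahn_banach_point_closed hC hC' h
  have : s ≤ f a := ge_of_tendsto (ha f) (hu.mono fun i hi => (hf _ hi).le)
  linarith

/-- A norm-bounded family in a Hilbert space converges weakly along every ultrafilter. -/
theorem exists_weak_limit_of_bounded [CompleteSpace X] {ι : Type*} (U : Ultrafilter ι)
    {u : ι → X} {C : ℝ} (hu : ∀ i, ‖u i‖ ≤ C) :
    ∃ a : X, ∀ w : X, Tendsto (fun i => ⟪u i, w⟫) U (𝓝 ⟪a, w⟫) := by
  let φ : ι → WeakDual ℝ X := fun i =>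
    StrongDual.toWeakDual (InnerProductSpace.toDual ℝ X (u i))
  obtain ⟨g, -, hg⟩ := (WeakDual.isCompact_closedBall (𝕜 := ℝ) (E := X) 0 C).ultrafilter_le_nhds'
    (U.map φ) (by
      refine Ultrafilter.mem_map.2 (Filter.univ_mem' fun i => ?_)
      change dist (InnerProductSpace.toDual ℝ X (u i)) 0 ≤ C
      simpa using hu i)
  refine ⟨(InnerProductSpace.toDual ℝ X).symm (WeakDual.toStrongDual g), fun w => ?_⟩
  have h : Tendsto φ U (𝓝 g) := hg
  have h2 := (WeakDual.eval_continuous (𝕜 := ℝ) w).continuousAt.tendsto.comp h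
  rw [InnerProductSpace.toDual_symm_apply]
  exact h2

/-- The first-order lower bound for a convex function with a gradient. -/
theorem ConvexOn.add_inner_le_of_hasGradientAt [CompleteSpace X] {F : X → ℝ} {g u : X}
    (hF : ConvexOn ℝ Set.univ F) (hg : HasGradientAt F g u) (v : X) :
    F u + ⟪g, v - u⟫ ≤ F v := by
  have hconv : ConvexOn ℝ Set.univ (fun t : ℝ => F (AffineMap.lineMap u v t)) := by
    exact hF.comp_affineMap (AffineMap.lineMap u v)
  have hd : HasDerivAt (fun t : ℝ => F (AffineMap.lineMap u v t)) ⟪g, v - u⟫ 0 := by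
    have hg' : HasFDerivAt F (InnerProductSpace.toDual ℝ X g)
        (AffineMap.lineMap u v (0 : ℝ)) := by
      simpa using hg.hasFDerivAt
    exact hg'.comp_hasDerivAt (0 : ℝ) AffineMap.hasDerivAt_lineMap
  have := hconv.le_slope_of_hasDerivAt (Set.mem_univ 0) (Set.mem_univ 1) one_pos hd
  simp [slope_def_field] at this
  linarith

/-- The descent lemma for a function with Lipschitz gradient. -/
theorem le_add_inner_add_sq_of_lipschitz_gradient [CompleteSpace X] {F : X → ℝ} {F' : X → X}
    {L : ℝ} (hgrad : ∀ u, HasGradientAt F (F' u) u)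
    (hlip : ∀ u v, ‖F' u - F' v‖ ≤ L * ‖u - v‖) (u v : X) :
    F v ≤ F u + ⟪F' u, v - u⟫ + L / 2 * ‖v - u‖ ^ 2 := by
  let φ : ℝ → ℝ := fun t =>
    F (AffineMap.lineMap u v t) - t * ⟪F' u, v - u⟫ - t ^ 2 * (L / 2 * ‖v - u‖ ^ 2)
  have hd : ∀ t : ℝ, HasDerivAt φ (⟪F' (AffineMap.lineMap u v t), v - u⟫ - ⟪F' u, v - u⟫
      - 2 * t * (L / 2 * ‖v - u‖ ^ 2)) t := fun t => by
    have h1 := (hgrad (AffineMap.lineMap u v t)).hasFDerivAt.comp_hasDerivAt t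
      AffineMap.hasDerivAt_lineMap
    have h2 := (hasDerivAt_id t).mul_const ⟪F' u, v - u⟫
    have h3 := ((hasDerivAt_id t).pow 2).mul_const (L / 2 * ‖v - u‖ ^ 2)
    refine ((h1.sub h2).sub h3).congr_deriv ?_
    simp
  have hanti : AntitoneOn φ (Set.Icc 0 1) := by
    refine antitoneOn_of_hasDerivWithinAt_nonpos (convex_Icc 0 1)
      (fun t _ => (hd t).continuousAt.continuousWithinAt)
      (fun t _ => (hd t).hasDerivWithinAt) fun t ht => ?_
    rw [interior_Icc] at ht
    rw [← inner_sub_left]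
    have h1 := real_inner_le_norm (F' (AffineMap.lineMap u v t) - F' u) (v - u)
    have h2 := hlip (AffineMap.lineMap u v t) u
    have h3 : ‖(AffineMap.lineMap u v t : X) - u‖ = t * ‖v - u‖ := by
      rw [AffineMap.lineMap_apply, vsub_eq_sub, vadd_eq_add, add_sub_cancel_right, norm_smul,
        Real.norm_of_nonneg ht.1.le]
    rw [h3] at h2
    nlinarith [mul_le_mul_of_nonneg_right h2 (norm_nonneg (v - u))]
  have := hanti (Set.left_mem_Icc.2 zero_le_one) (Set.right_mem_Icc.2 zero_le_one) zero_le_one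
  simp [φ] at this
  linarith

/-- The variational inequality characterizing proximal points, in terms of real upper bounds
for the values of the function. -/
theorem IsProx.add_inner_le {R : X → EReal} {τ : ℝ} {w p u : X} {rp ru : ℝ} (hτ : 0 < τ)
    (hR : ERealConvex R) (hp : IsProx R τ w p) (hrp : R p = rp) (hru : R u ≤ ru) :
    rp + 1 / τ * ⟪w - p, u - p⟫ ≤ ru := by
  have key : ∀ t : ℝ, 0 < t → t ≤ 1 →
      rp + 1 / τ * ⟪w - p, u - p⟫ ≤ ru + t * (1 / (2 * τ) * ‖u - p‖ ^ 2) := fun t h0 h1 => by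
    have h2 := hp (t • u + (1 - t) • p)
    have h3 : R (t • u + (1 - t) • p) ≤ ((t * ru + (1 - t) * rp : ℝ) : EReal) := by
      refine (hR u p t h0.le h1).trans ?_
      rw [hrp]
      push_cast
      gcongr
    have h4 := h2.trans (add_le_add_left h3 _)
    rw [hrp] at h4
    norm_cast at h4
    have h5 : t • u + (1 - t) • p - w = t • (u - p) - (w - p) := by module
    rw [h5, ← norm_neg (p - w), neg_sub, norm_sub_sq_real (t • (u - p)), norm_smul,
      real_inner_smul_left, Real.norm_of_nonneg h0.le, real_inner_comm] at h4
    have h6 : t * (rp + 1 / τ * ⟪w - p, u - p⟫)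
        ≤ t * (ru + t * (1 / (2 * τ) * ‖u - p‖ ^ 2)) := by
      have : 1 / τ = 2 * (1 / (2 * τ)) := by field_simp
      rw [this]
      nlinarith
    exact le_of_mul_le_mul_left h6 h0
  refine ge_of_tendsto (x := 𝓝[>] (0 : ℝ))
    (f := fun t => ru + t * (1 / (2 * τ) * ‖u - p‖ ^ 2)) ?_ ?_
  · have : Continuous fun t : ℝ => ru + t * (1 / (2 * τ) * ‖u - p‖ ^ 2) := by fun_prop
    simpa using (this.tendsto 0).mono_left nhdsWithin_le_nhds
  · filter_upwards [Ioc_mem_nhdsGT one_pos] with t ht using key t ht.1 ht.2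

/-- The real epigraph of `R + F`, where `F` is real-valued. -/
def sumEpigraph {X : Type*} (R : X → EReal) (F : X → ℝ) : Set (X × ℝ) :=
  {p | R p.1 ≤ ((p.2 - F p.1 : ℝ) : EReal)}

theorem convex_sumEpigraph {R : X → EReal} {F : X → ℝ} (hR : ERealConvex R)
    (hF : ConvexOn ℝ Set.univ F) : Convex ℝ (sumEpigraph R F) := by
  rintro ⟨x, s⟩ hx ⟨y, t⟩ hy a b ha hb hab
  obtain rfl : b = 1 - a := by linarith
  have h1 := hF.2 (Set.mem_univ x) (Set.mem_univ y) ha hb hab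
  have h2 := hR x y a ha (by linarith)
  refine h2.trans (le_trans (b := ((a * (s - F x) + (1 - a) * (t - F y) : ℝ) : EReal)) ?_ ?_)
  · push_cast [-EReal.coe_sub]
    gcongr
    · exact hx
    · exact hy
  · simp only [smul_eq_mul] at h1
    refine EReal.coe_le_coe_iff.2 ?_
    simp only [Prod.snd_add, Prod.smul_snd, Prod.fst_add, Prod.smul_fst, smul_eq_mul]
    linarith

theorem isClosed_sumEpigraph {X : Type*} [TopologicalSpace X] {R : X → EReal} {F : X → ℝ} (hR : LowerSemicontinuous R)
    (hF : Continuous F) : IsClosed (sumEpigraph R F) := by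
  have h : Continuous fun p : X × ℝ => (p.1, ((p.2 - F p.1 : ℝ) : EReal)) :=
    continuous_fst.prodMk
      (continuous_coe_real_ereal.comp (continuous_snd.sub (hF.comp continuous_fst)))
  exact hR.isClosed_epigraph.preimage h

end ConvexAnalysis

section RunningAverage

variable {E : Type*} [NormedAddCommGroup E] [NormedSpace ℝ E]

/-- The average of `u 1, …, u k`. -/
def runningAverage (u : ℕ → E) (k : ℕ) : E :=
  (k : ℝ)⁻¹ • ∑ j ∈ Finset.Icc 1 k, u j

theorem Convex.runningAverage_mem {C : Set E} (hC : Convex ℝ C) {u : ℕ → E}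
    (hu : ∀ j, u (j + 1) ∈ C) {k : ℕ} (hk : 1 ≤ k) : runningAverage u k ∈ C := by
  rw [runningAverage, Finset.smul_sum]
  refine hC.sum_mem (fun _ _ => by positivity) ?_ fun j hj => ?_
  · have : (k : ℝ) ≠ 0 := by positivity
    simp [this]
  · obtain ⟨i, rfl⟩ := Nat.exists_eq_add_of_le' (Finset.mem_Icc.1 hj).1
    exact hu i

theorem norm_runningAverage_le {u : ℕ → E} {C : ℝ} (hu : ∀ j, ‖u (j + 1)‖ ≤ C) (k : ℕ) :
    ‖runningAverage u k‖ ≤ C := by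
  rcases Nat.eq_zero_or_pos k with rfl | hk
  · simpa [runningAverage] using (norm_nonneg _).trans (hu 0)
  · simpa using (convex_closedBall (0 : E) C).runningAverage_mem
      (fun j => by simpa using hu j) hk

theorem tendsto_runningAverage {u : ℕ → E} {l : E} (hu : Tendsto u atTop (𝓝 l)) :
    Tendsto (runningAverage u) atTop (𝓝 l) := by
  refine ((tendsto_add_atTop_iff_nat 1).2 hu).cesaro_smul.congr fun k => ?_
  rw [runningAverage, Finset.range_eq_Ico, Finset.sum_Ico_add' u 0 k 1]
  rfl

theorem runningAverage_map {G : Type*} [NormedAddCommGroup G] [NormedSpace ℝ G]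
    (f : E →L[ℝ] G) (u : ℕ → E) (k : ℕ) :
    runningAverage (fun j => f (u j)) k = f (runningAverage u k) := by
  simp [runningAverage]

theorem runningAverage_add (u v : ℕ → E) (k : ℕ) :
    runningAverage (fun j => u j + v j) k = runningAverage u k + runningAverage v k := by
  simp [runningAverage, Finset.sum_add_distrib]

theorem runningAverage_const (a : E) {k : ℕ} (hk : 1 ≤ k) :
    runningAverage (fun _ => a) k = a := by
  have : (k : ℝ) ≠ 0 := by positivity
  simp [runningAverage, ← Nat.cast_smul_eq_nsmul ℝ, smul_smul, this]

theorem runningAverage_natCast {k : ℕ} (hk : 1 ≤ k) :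
    runningAverage (fun j : ℕ => (j : ℝ)) k = ((k : ℝ) + 1) / 2 := by
  have hsum : ∀ n : ℕ, ∑ j ∈ Finset.Icc 1 n, (j : ℝ) = n * (n + 1) / 2 := fun n => by
    induction n with
    | zero => simp
    | succ n ih =>
      rw [Finset.sum_Icc_succ_top (by omega), ih]
      push_cast
      ring
  have : (k : ℝ) ≠ 0 := by positivity
  rw [runningAverage, hsum, smul_eq_mul]
  field_simp

end RunningAverage

section Ergodic

/-- The Lyapunov function `½⟪(τ⁻¹ - σ A*A)(x - u), x - u⟫ + (2σ)⁻¹‖y - v‖²`. -/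
def pdEnergy (A : X →L[ℝ] Y) (τ σ : ℝ) (x : X) (y : Y) (u : X) (v : Y) : ℝ :=
  1 / 2 * (1 / τ * ‖x - u‖ ^ 2 - σ * ‖A (x - u)‖ ^ 2) + 1 / (2 * σ) * ‖y - v‖ ^ 2

/-- `(u, v)` is a saddle point with value `ρ₀` for minimizing `ρ` over the pairs `(u, ρ) ∈ E`
with `A u = c`. -/
structure IsEpiSaddle (E : Set (X × ℝ)) (A : X →L[ℝ] Y) (c : Y) (ρ₀ : ℝ) (u : X) (v : Y) :
    Prop where
  mem : (u, ρ₀) ∈ E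
  feasible : A u = c
  le : ∀ p ∈ E, ρ₀ ≤ p.2 + ⟪v, A p.1 - c⟫

/-- Iterates in a closed convex epigraph `E` along which the primal-dual gap is bounded by the
decrease of `pdEnergy`. -/
structure IsPDSequence (E : Set (X × ℝ)) (A : X →L[ℝ] Y) (c : Y) (τ σ : ℝ)
    (x : ℕ → X) (y : ℕ → Y) (g : ℕ → ℝ) : Prop where
  convex : Convex ℝ E
  isClosed : IsClosed E
  upward : ∀ p ∈ E, ∀ t, p.2 ≤ t → (p.1, t) ∈ E
  τ_pos : 0 < τ
  σ_pos : 0 < σ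
  metric_nonneg : ∀ d : X, σ * ‖A d‖ ^ 2 ≤ 1 / τ * ‖d‖ ^ 2
  mem : ∀ k, (x (k + 1), g (k + 1)) ∈ E
  dual : ∀ k, y (k + 1) = y k + σ • (A (x (k + 1)) - c)
  gap_le : ∀ p ∈ E, ∀ v k,
    g (k + 1) + ⟪v, A (x (k + 1)) - c⟫ - p.2 - ⟪y (k + 1), A p.1 - c⟫
      ≤ pdEnergy A τ σ (x k) (y k) p.1 v - pdEnergy A τ σ (x (k + 1)) (y (k + 1)) p.1 v

namespace IsPDSequence

variable {E : Set (X × ℝ)} {A : X →L[ℝ] Y} {c : Y} {τ σ : ℝ}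
  {x : ℕ → X} {y : ℕ → Y} {g : ℕ → ℝ}

omit [CompleteSpace X] [CompleteSpace Y] in
theorem pdEnergy_nonneg (h : IsPDSequence E A c τ σ x y g) (k : ℕ) (u : X) (v : Y) :
    0 ≤ pdEnergy A τ σ (x k) (y k) u v := by
  have := h.metric_nonneg (x k - u)
  have := h.σ_pos
  have : 0 ≤ 1 / (2 * σ) * ‖y k - v‖ ^ 2 := by positivity
  unfold pdEnergy
  linarith

omit [CompleteSpace X] [CompleteSpace Y] in
theorem runningAverage_gap_le (h : IsPDSequence E A c τ σ x y g) {p : X × ℝ} (hp : p ∈ E)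
    (v : Y) {k : ℕ} (hk : 1 ≤ k) :
    runningAverage g k + ⟪v, A (runningAverage x k) - c⟫ - p.2
        - ⟪runningAverage y k, A p.1 - c⟫
      ≤ (k : ℝ)⁻¹ * pdEnergy A τ σ (x 0) (y 0) p.1 v := by
  let f : ℕ → ℝ := fun j => g j + ⟪v, A (x j) - c⟫ - p.2 - ⟪y j, A p.1 - c⟫
  have hsum : ∀ n : ℕ, ∑ j ∈ Finset.Icc 1 n, f j ≤
      pdEnergy A τ σ (x 0) (y 0) p.1 v - pdEnergy A τ σ (x n) (y n) p.1 v := fun n => by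
    induction n with
    | zero => simp
    | succ n ih =>
      rw [Finset.sum_Icc_succ_top (by omega)]
      have := h.gap_le p hp v n
      simp only [f] at ih ⊢
      linarith
  have hf : runningAverage f k = runningAverage g k + ⟪v, A (runningAverage x k) - c⟫ - p.2
        - ⟪runningAverage y k, A p.1 - c⟫ := by
    have h1 : f = fun j => g j + ((innerSL ℝ v ∘L A) (x j)
        + ((-innerSL ℝ (A p.1 - c)) (y j) + (-⟪v, c⟫ - p.2))) := by
      funext j
      simp [f, inner_sub_right, real_inner_comm]
      ring
    rw [h1, runningAverage_add, runningAverage_add, runningAverage_add, runningAverage_map,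
      runningAverage_map, runningAverage_const _ hk]
    simp [inner_sub_right, real_inner_comm]
    ring
  rw [← hf, runningAverage, smul_eq_mul]
  gcongr
  linarith [hsum k, h.pdEnergy_nonneg k p.1 v]

/-- Weak cluster points of the averages satisfy the saddle-point inequality. -/
theorem cluster_mem (h : IsPDSequence E A c τ σ x y g) {U : Ultrafilter ℕ}
    (hU : (U : Filter ℕ) ≤ atTop) {a : X} {d : Y}
    (ha : ∀ w : X, Tendsto (fun k => ⟪runningAverage x k, w⟫) U (𝓝 ⟪a, w⟫))
    (hd : ∀ w : Y, Tendsto (fun k => ⟪runningAverage y k, w⟫) U (𝓝 ⟪d, w⟫))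
    {p : X × ℝ} (hp : p ∈ E) (v : Y) :
    (a, p.2 + ⟪d, A p.1 - c⟫ - ⟪v, A a - c⟫) ∈ E := by
  let s : ℕ → ℝ := fun k => p.2 + ⟪runningAverage y k, A p.1 - c⟫
    - ⟪v, A (runningAverage x k) - c⟫ + (k : ℝ)⁻¹ * pdEnergy A τ σ (x 0) (y 0) p.1 v
  have hmem : ∀ k, 1 ≤ k → (runningAverage x k, s k) ∈ E := fun k hk => by
    have h1 : (runningAverage x k, runningAverage g k) ∈ E := by
      have h2 := h.convex.runningAverage_mem (u := fun j => (x j, g j)) h.mem hk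
      have h3 := runningAverage_map (ContinuousLinearMap.fst ℝ X ℝ) (fun j => (x j, g j)) k
      have h4 := runningAverage_map (ContinuousLinearMap.snd ℝ X ℝ) (fun j => (x j, g j)) k
      have h5 : (runningAverage x k, runningAverage g k) = runningAverage (fun j => (x j, g j)) k :=
        Prod.ext h3 h4
      rwa [h5]
    refine h.upward _ h1 _ ?_
    have := h.runningAverage_gap_le hp v hk
    simp only [s]
    linarith
  have hs : Tendsto s U (𝓝 (p.2 + ⟪d, A p.1 - c⟫ - ⟪v, A a - c⟫)) := by
    have h1 : Tendsto (fun k => ⟪v, A (runningAverage x k) - c⟫) U (𝓝 ⟪v, A a - c⟫) := by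
      have h2 := (ha (ContinuousLinearMap.adjoint A v)).sub_const ⟪v, c⟫
      simpa [ContinuousLinearMap.adjoint_inner_right, inner_sub_right,
        real_inner_comm v] using h2
    have h3 : Tendsto (fun k : ℕ => (k : ℝ)⁻¹ * pdEnergy A τ σ (x 0) (y 0) p.1 v) U (𝓝 0) := by
      simpa using ((tendsto_inv_atTop_nhds_zero_nat (𝕜 := ℝ)).mono_left hU).mul_const
        (pdEnergy A τ σ (x 0) (y 0) p.1 v)
    simpa using (((hd (A p.1 - c)).const_add p.2).sub h1).add h3
  refine h.convex.mem_of_tendsto_weak h.isClosed (l := (U : Filter ℕ))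
    (u := fun k => (runningAverage x k, s k)) (hU ((eventually_ge_atTop 1).mono hmem)) fun f => ?_
  have hf : ∀ q : X × ℝ, f q =
      ⟪q.1, (InnerProductSpace.toDual ℝ X).symm (f ∘L ContinuousLinearMap.inl ℝ X ℝ)⟫
        + q.2 * f (0, 1) := fun q => by
    rw [real_inner_comm, InnerProductSpace.toDual_symm_apply, ← smul_eq_mul, ← map_smul]
    change f q = f (q.1, 0) + f (q.2 • ((0 : X), (1 : ℝ)))
    rw [← map_add]
    simp
  rw [hf (a, _)]
  exact ((ha _).add (hs.mul_const _)).congr fun k => (hf _).symm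

theorem cluster_isEpiSaddle (h : IsPDSequence E A c τ σ x y g) {ρ₀ : ℝ} {u₀ : X} {v₀ : Y}
    (h₀ : IsEpiSaddle E A c ρ₀ u₀ v₀) {U : Ultrafilter ℕ}
    (hU : (U : Filter ℕ) ≤ atTop) {a : X} {d : Y}
    (ha : ∀ w : X, Tendsto (fun k => ⟪runningAverage x k, w⟫) U (𝓝 ⟪a, w⟫))
    (hd : ∀ w : Y, Tendsto (fun k => ⟪runningAverage y k, w⟫) U (𝓝 ⟪d, w⟫)) :
    IsEpiSaddle E A c ρ₀ a d := by
  have hA : A a = c := by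
    have h1 := h₀.le _ (h.cluster_mem hU ha hd h₀.mem (v₀ + (A a - c)))
    simp only [h₀.feasible, sub_self, inner_zero_right, inner_add_left,
      real_inner_self_eq_norm_sq] at h1
    have h2 : ‖A a - c‖ ^ 2 = 0 := le_antisymm (by linarith) (by positivity)
    exact sub_eq_zero.1 (norm_eq_zero.1 (pow_eq_zero_iff two_ne_zero |>.1 h2))
  have hmem := fun p (hp : p ∈ E) => h.cluster_mem hU ha hd hp 0
  refine ⟨?_, hA, fun p hp => ?_⟩
  · simpa [h₀.feasible] using hmem _ h₀.mem
  · simpa [hA] using h₀.le _ (hmem p hp)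

omit [CompleteSpace X] [CompleteSpace Y] in
theorem antitone_pdEnergy (h : IsPDSequence E A c τ σ x y g) {ρ₀ : ℝ} {u : X} {v : Y}
    (hs : IsEpiSaddle E A c ρ₀ u v) :
    Antitone fun k => pdEnergy A τ σ (x k) (y k) u v := by
  refine antitone_nat_of_succ_le fun k => ?_
  have h1 := h.gap_le _ hs.mem v k
  have h2 := hs.le _ (h.mem k)
  simp only [hs.feasible, sub_self, inner_zero_right] at h1
  linarith

omit [CompleteSpace X] [CompleteSpace Y] in
theorem exists_norm_le (h : IsPDSequence E A c τ σ x y g) {ρ₀ : ℝ} {u : X} {v : Y}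
    (hs : IsEpiSaddle E A c ρ₀ u v) :
    ∃ C, ∀ k, ‖x (k + 1)‖ ≤ C ∧ ‖y (k + 1)‖ ≤ C := by
  have hσ := h.σ_pos
  have hτ := h.τ_pos
  set V := pdEnergy A τ σ (x 0) (y 0) u v
  have hy : ∀ k, ‖y k - v‖ ^ 2 ≤ 2 * σ * V := fun k => by
    have h1 : pdEnergy A τ σ (x k) (y k) u v ≤ V := h.antitone_pdEnergy hs (Nat.zero_le k)
    have h2 := h.metric_nonneg (x k - u)
    have h3 : 1 / (2 * σ) * ‖y k - v‖ ^ 2 ≤ V := by unfold pdEnergy at h1; linarith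
    rw [one_div_mul_eq_div, div_le_iff₀ (by positivity)] at h3
    linarith
  have hx : ∀ k, ‖x (k + 1) - u‖ ^ 2 ≤ τ * (10 * V) := fun k => by
    have h1 : pdEnergy A τ σ (x (k + 1)) (y (k + 1)) u v ≤ V :=
      h.antitone_pdEnergy hs (Nat.zero_le _)
    have h2 : σ • A (x (k + 1) - u) = (y (k + 1) - v) - (y k - v) := by
      rw [h.dual k, map_sub, hs.feasible]; abel
    have h3 : σ ^ 2 * ‖A (x (k + 1) - u)‖ ^ 2 ≤ 8 * σ * V := by
      have h4 := parallelogram_law_with_norm ℝ (y (k + 1) - v) (y k - v)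
      rw [← h2, norm_smul, Real.norm_of_nonneg hσ.le] at h4
      nlinarith [hy k, hy (k + 1), mul_self_nonneg ‖y (k + 1) - v + (y k - v)‖]
    have h5 : σ * ‖A (x (k + 1) - u)‖ ^ 2 ≤ 8 * V := by
      refine le_of_mul_le_mul_left ?_ hσ
      linarith
    have h6 : 0 ≤ 1 / (2 * σ) * ‖y (k + 1) - v‖ ^ 2 := by positivity
    have h7 : 1 / τ * ‖x (k + 1) - u‖ ^ 2 ≤ 10 * V := by unfold pdEnergy at h1; linarith
    rw [one_div_mul_eq_div, div_le_iff₀ hτ] at h7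
    linarith
  refine ⟨max (‖u‖ + √(τ * (10 * V))) (‖v‖ + √(2 * σ * V)), fun k =>
    ⟨le_max_of_le_left ?_, le_max_of_le_right ?_⟩⟩
  · linarith [norm_le_norm_add_norm_sub' (x (k + 1)) u, Real.le_sqrt_of_sq_le (hx k)]
  · linarith [norm_le_norm_add_norm_sub' (y (k + 1)) v, Real.le_sqrt_of_sq_le (hy (k + 1))]

omit [CompleteSpace X] [CompleteSpace Y] in
/-- Two saddle points that are both weak cluster points of the averages have the same primal
component. -/
theorem cluster_unique (h : IsPDSequence E A c τ σ x y g) {ρ₁ ρ₂ : ℝ} {a₁ a₂ : X} {d₁ d₂ : Y}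
    (h₁ : IsEpiSaddle E A c ρ₁ a₁ d₁) (h₂ : IsEpiSaddle E A c ρ₂ a₂ d₂) {U₁ U₂ : Ultrafilter ℕ}
    (hU₁ : (U₁ : Filter ℕ) ≤ atTop) (hU₂ : (U₂ : Filter ℕ) ≤ atTop)
    (ha₁ : ∀ w : X, Tendsto (fun k => ⟪runningAverage x k, w⟫) U₁ (𝓝 ⟪a₁, w⟫))
    (hd₁ : ∀ w : Y, Tendsto (fun k => ⟪runningAverage y k, w⟫) U₁ (𝓝 ⟪d₁, w⟫))
    (ha₂ : ∀ w : X, Tendsto (fun k => ⟪runningAverage x k, w⟫) U₂ (𝓝 ⟪a₂, w⟫))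
    (hd₂ : ∀ w : Y, Tendsto (fun k => ⟪runningAverage y k, w⟫) U₂ (𝓝 ⟪d₂, w⟫)) :
    a₁ = a₂ := by
  have hσ := h.σ_pos
  have hτ := h.τ_pos
  have hlim : ∀ {ρ : ℝ} {u : X} {v : Y}, IsEpiSaddle E A c ρ u v →
      ∃ l, Tendsto (fun k => pdEnergy A τ σ (x k) (y k) u v) atTop (𝓝 l) := fun hs =>
    ⟨_, tendsto_atTop_ciInf (h.antitone_pdEnergy hs)
      ⟨0, Set.forall_mem_range.2 fun k => h.pdEnergy_nonneg k _ _⟩⟩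
  obtain ⟨l₁, hl₁⟩ := hlim h₁
  obtain ⟨l₂, hl₂⟩ := hlim h₂
  let f : ℕ → ℝ := fun k => 1 / τ * ⟪x k, a₁ - a₂⟫ + 1 / σ * ⟪y k, d₁ - d₂⟫
  obtain ⟨l, hl⟩ : ∃ l, Tendsto f atTop (𝓝 l) := by
    refine ⟨_, ((hl₂.sub hl₁).add_const (1 / (2 * τ) * (‖a₁‖ ^ 2 - ‖a₂‖ ^ 2)
      + 1 / (2 * σ) * (‖d₁‖ ^ 2 - ‖d₂‖ ^ 2))).congr fun k => ?_⟩
    simp only [pdEnergy, map_sub, h₁.feasible, h₂.feasible, f, norm_sub_sq_real (x k),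
      norm_sub_sq_real (y k), inner_sub_right]
    field_simp
    ring
  have havg : ∀ {U : Ultrafilter ℕ} {a : X} {d : Y}, (U : Filter ℕ) ≤ atTop →
      (∀ w : X, Tendsto (fun k => ⟪runningAverage x k, w⟫) U (𝓝 ⟪a, w⟫)) →
      (∀ w : Y, Tendsto (fun k => ⟪runningAverage y k, w⟫) U (𝓝 ⟪d, w⟫)) →
      1 / τ * ⟪a, a₁ - a₂⟫ + 1 / σ * ⟪d, d₁ - d₂⟫ = l := fun {U a d} hU ha hd => by
    refine tendsto_nhds_unique (((ha (a₁ - a₂)).const_mul (1 / τ)).add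
      ((hd (d₁ - d₂)).const_mul (1 / σ)))
      (((tendsto_runningAverage hl).mono_left hU).congr fun k => ?_)
    have hf : f = fun j => ((1 / τ) • innerSL ℝ (a₁ - a₂)) (x j)
        + ((1 / σ) • innerSL ℝ (d₁ - d₂)) (y j) := by
      funext j
      simp [f, inner_sub_right, real_inner_comm]
    rw [hf, runningAverage_add, runningAverage_map, runningAverage_map]
    simp [inner_sub_right, real_inner_comm]
  have h3 := havg hU₁ ha₁ hd₁
  have h4 := havg hU₂ ha₂ hd₂
  have h5 : 1 / τ * ‖a₁ - a₂‖ ^ 2 + 1 / σ * ‖d₁ - d₂‖ ^ 2 = 0 := by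
    rw [← real_inner_self_eq_norm_sq, ← real_inner_self_eq_norm_sq, inner_sub_left,
      inner_sub_left (𝕜 := ℝ) d₁]
    linarith
  have h6 : 0 ≤ 1 / σ * ‖d₁ - d₂‖ ^ 2 := by positivity
  have h7 : ‖a₁ - a₂‖ ^ 2 ≤ 0 := by
    refine le_of_mul_le_mul_left ?_ (one_div_pos.2 hτ)
    linarith
  exact sub_eq_zero.1 (norm_eq_zero.1 (pow_eq_zero_iff two_ne_zero |>.1
    (le_antisymm h7 (by positivity))))

theorem exists_weakTendsto_runningAverage (h : IsPDSequence E A c τ σ x y g) {ρ₀ : ℝ} {u₀ : X}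
    {v₀ : Y} (h₀ : IsEpiSaddle E A c ρ₀ u₀ v₀) :
    ∃ a d, IsEpiSaddle E A c ρ₀ a d ∧ WeakTendsto (runningAverage x) a := by
  obtain ⟨C, hC⟩ := h.exists_norm_le h₀
  have hx := fun U : Ultrafilter ℕ => exists_weak_limit_of_bounded U
    (norm_runningAverage_le fun j => (hC j).1)
  have hy := fun U : Ultrafilter ℕ => exists_weak_limit_of_bounded U
    (norm_runningAverage_le fun j => (hC j).2)
  choose a ha using hx
  choose d hd using hy
  have hs := fun U (hU : ((U : Ultrafilter ℕ) : Filter ℕ) ≤ atTop) =>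
    h.cluster_isEpiSaddle h₀ hU (ha U) (hd U)
  have hW := Ultrafilter.of_le (atTop : Filter ℕ)
  refine ⟨_, _, hs _ hW, fun w => (tendsto_iff_ultrafilter _ _ _).2 fun U hU => ?_⟩
  rw [← h.cluster_unique (hs U hU) (hs _ hW) hU hW (ha U) (hd U) (ha _) (hd _)]
  exact ha U w

end IsPDSequence

end Ergodic

/-- One primal-dual step decreases `pdEnergy` by at least the primal-dual gap. -/
theorem IsProx.gap_le {A : X →L[ℝ] Y} {c : Y} {R : X → EReal} {F : X → ℝ} {F' : X → X}
    {L τ σ : ℝ} (hR : ERealConvex R) (hF : ConvexOn ℝ Set.univ F)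
    (hgrad : ∀ u, HasGradientAt F (F' u) u) (hlip : ∀ u v, ‖F' u - F' v‖ ≤ L * ‖u - v‖)
    (hτ : 0 < τ) (hσ : 0 < σ) (hstep : ∀ d : X, L * ‖d‖ ^ 2 + σ * ‖A d‖ ^ 2 ≤ 1 / τ * ‖d‖ ^ 2)
    {x x' : X} {y y' : Y} {r : ℝ}
    (hx' : IsProx R τ
      (x - τ • F' x - τ • ContinuousLinearMap.adjoint A (y + σ • (A x - c))) x')
    (hr : R x' = r) (hy' : y' = y + σ • (A x' - c))
    {p : X × ℝ} (hp : p ∈ sumEpigraph R F) (v : Y) :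
    r + F x' + ⟪v, A x' - c⟫ - p.2 - ⟪y', A p.1 - c⟫
      ≤ pdEnergy A τ σ x y p.1 v - pdEnergy A τ σ x' y' p.1 v := by
  obtain ⟨u, ρ⟩ := p
  have h1 := hx'.add_inner_le hτ hR hr hp
  have h2 := hF.add_inner_le_of_hasGradientAt (hgrad x) u
  have h3 := le_add_inner_add_sq_of_lipschitz_gradient hgrad hlip x x'
  have h4 := hstep (x - x')
  obtain ⟨d, rfl⟩ : ∃ d, x = d + x' := ⟨x - x', by abel⟩
  obtain ⟨e, rfl⟩ : ∃ e, x' = e + u := ⟨x' - u, by abel⟩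
  obtain ⟨q, rfl⟩ : ∃ q, v = y + q := ⟨v - y, by abel⟩
  subst hy'
  obtain ⟨s, hs⟩ : ∃ s, A u = s + c := ⟨A u - c, by abel⟩
  simp only [pdEnergy]
  have e1 : d + (e + u) - τ • F' (d + (e + u))
      - τ • ContinuousLinearMap.adjoint A (y + σ • (A (d + (e + u)) - c)) - (e + u)
      = d - τ • (F' (d + (e + u))
        + ContinuousLinearMap.adjoint A (y + σ • (A d + A e + s))) := by
    have : A (d + (e + u)) - c = A d + A e + s := by simp only [map_add, hs]; abel
    rw [this]
    module
  have e2 : u - (e + u) = -e := by abel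
  have e3 : u - (d + (e + u)) = -(d + e) := by abel
  have e4 : e + u - (d + (e + u)) = -d := by abel
  have e5 : d + (e + u) - (e + u) = d := by abel
  have e6 : d + (e + u) - u = d + e := by abel
  have e7 : e + u - u = e := by abel
  have e8 : A (e + u) - c = A e + s := by rw [map_add, hs]; abel
  have e9 : A u - c = s := by rw [hs]; abel
  have e10 : y + σ • (A e + s) - (y + q) = σ • (A e + s) - q := by abel
  have e11 : y - (y + q) = -q := by abel
  dsimp only at h1 ⊢
  rw [e1, e2] at h1
  rw [e3] at h2
  rw [e4] at h3
  rw [e5] at h4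
  rw [e6, e7, e8, e9, e10, e11, norm_neg, norm_sub_sq_real (σ • (A e + s)), map_add,
    norm_add_sq_real d, norm_add_sq_real (A d), norm_smul, mul_pow, norm_add_sq_real (A e)]
  simp only [norm_neg, inner_neg_right, inner_sub_left, inner_add_left, inner_add_right,
    real_inner_smul_left, ContinuousLinearMap.adjoint_inner_left] at h1 h2 h3 ⊢
  have e12 : ∀ a b : ℝ, 1 / τ * -(a - τ * b) = b - 1 / τ * a := fun a b => by
    field_simp
    ring
  have e13 : ∀ a b z : ℝ, 1 / (2 * σ) * (σ ^ 2 * a - 2 * (σ * b) + z)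
      = σ / 2 * a - b + 1 / (2 * σ) * z := fun a b z => by
    field_simp
  rw [e12] at h1
  rw [Real.norm_of_nonneg hσ.le, e13, real_inner_comm s (A e), real_inner_comm q (A e),
    real_inner_comm q s, real_inner_self_eq_norm_sq]
  rw [real_inner_self_eq_norm_sq] at h1
  have h5 : 0 ≤ σ / 2 * ‖A e + s‖ ^ 2 := by positivity
  rw [norm_add_sq_real, real_inner_comm s (A e)] at h5
  linarith

/-- If the normal problem admits a saddle point and
`1 - τ(L + σ‖A‖²) ≥ 0`, the averaged primal iterates converge weakly to a minimizer of
`R + F` over `{x : A*A x = A*b}`; moreover if `min {R + F : A x = b}` has no solution then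
`‖ŷ_k‖ → +∞`. -/
theorem statement_9
    (A : X →L[ℝ] Y) (b : Y)
    (R : X → EReal) (hR : ProperConvexLsc R)
    (F : X → ℝ) (F' : X → X) (L : ℝ) (hL : 0 ≤ L)
    (hFconv : ConvexOn ℝ Set.univ F)
    (hFgrad : ∀ u : X, HasGradientAt F (F' u) u)
    (hFlip : ∀ u v : X, ‖F' u - F' v‖ ≤ L * ‖u - v‖)
    (τ σ : ℝ) (hτ : 0 < τ) (hσ : 0 < σ)
    (hstepsize : 0 ≤ 1 - τ * (L + σ * ‖A‖ ^ 2))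
    (xtil vtil : X)
    (hsubdiff : -(ContinuousLinearMap.adjoint A (A vtil)) - F' xtil ∈ epsSubdiff R 0 xtil)
    (hfeas : ContinuousLinearMap.adjoint A (A xtil) = ContinuousLinearMap.adjoint A b)
    (x : ℕ → X) (y : ℕ → Y) (ym1 : Y)
    (hinit : y 0 = ym1 + σ • (A (x 0) - b))
    (hstep : ∀ k : ℕ,
      IsProx R τ
        (x k - τ • F' (x k)
          - τ • ContinuousLinearMap.adjoint A
              ((2 : ℝ) • y k - (if k = 0 then ym1 else y (k - 1))))
        (x (k + 1)))
    (hdual : ∀ k : ℕ, y (k + 1) = y k + σ • (A (x (k + 1)) - b)) :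
    (∃ xinf : X,
      ContinuousLinearMap.adjoint A (A xinf) = ContinuousLinearMap.adjoint A b ∧
      (∀ u : X, ContinuousLinearMap.adjoint A (A u) = ContinuousLinearMap.adjoint A b →
        R xinf + (F xinf : EReal) ≤ R u + (F u : EReal)) ∧
      WeakTendsto (fun k : ℕ => (k : ℝ)⁻¹ • ∑ j ∈ Finset.Icc 1 k, x j) xinf) ∧
    ((¬ ∃ xs : X, A xs = b ∧
        ∀ u : X, A u = b → R xs + (F xs : EReal) ≤ R u + (F u : EReal)) →
      Tendsto (fun k : ℕ => ‖(k : ℝ)⁻¹ • ∑ j ∈ Finset.Icc 1 k, y j‖) atTop atTop) := by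
  have hF : Continuous F :=
    continuous_iff_continuousAt.2 fun u => (hFgrad u).differentiableAt.continuousAt
  obtain ⟨⟨u₀, hu₀⟩, hbot, hconv, hlsc⟩ := hR
  have hstep' : ∀ d : X, L * ‖d‖ ^ 2 + σ * ‖A d‖ ^ 2 ≤ 1 / τ * ‖d‖ ^ 2 := fun d => by
    have h1 : ‖A d‖ ^ 2 ≤ ‖A‖ ^ 2 * ‖d‖ ^ 2 := by
      rw [← mul_pow]
      gcongr
      exact A.le_opNorm d
    have h2 : L + σ * ‖A‖ ^ 2 ≤ 1 / τ := by
      rw [le_div_iff₀ hτ]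
      linarith
    calc L * ‖d‖ ^ 2 + σ * ‖A d‖ ^ 2 ≤ L * ‖d‖ ^ 2 + σ * (‖A‖ ^ 2 * ‖d‖ ^ 2) := by gcongr
      _ = (L + σ * ‖A‖ ^ 2) * ‖d‖ ^ 2 := by ring
      _ ≤ 1 / τ * ‖d‖ ^ 2 := by gcongr
  have hnormal : ∀ u : X,
      ContinuousLinearMap.adjoint A (A u) = ContinuousLinearMap.adjoint A b ↔ A u = A xtil :=
    fun u => by
      refine ⟨fun hu => ?_, fun hu => by rw [hu, hfeas]⟩
      have h1 : ContinuousLinearMap.adjoint A (A (u - xtil)) = 0 := by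
        rw [map_sub, map_sub, hu, hfeas, sub_self]
      have h2 := ContinuousLinearMap.adjoint_inner_left A (u - xtil) (A (u - xtil))
      rw [h1, inner_zero_left] at h2
      have h3 := inner_self_eq_zero.1 h2.symm
      rwa [map_sub, sub_eq_zero] at h3
  have hreal : ∀ u, R u ≠ ⊤ → ((R u).toReal : EReal) = R u := fun u hu =>
    EReal.coe_toReal hu (hbot u)
  have hepi : ∀ u, R u ≠ ⊤ → (u, (R u).toReal + F u) ∈ sumEpigraph R F := fun u hu => by
    change R u ≤ (((R u).toReal + F u - F u : ℝ) : EReal)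
    rw [add_sub_cancel_right, hreal u hu]
  have hsub : ∀ u, R xtil +
      ((⟪-(ContinuousLinearMap.adjoint A (A vtil)) - F' xtil, u - xtil⟫ : ℝ) : EReal) ≤ R u := by
    simpa [epsSubdiff] using hsubdiff
  have hxtil : R xtil ≠ ⊤ := fun h => hu₀ (by simpa [h] using hsub u₀)
  have hxfin : ∀ k, R (x (k + 1)) ≠ ⊤ := fun k h => by
    have h1 := hstep k u₀
    rw [h, EReal.top_add_coe, top_le_iff, ← hreal u₀ hu₀, ← EReal.coe_add] at h1
    exact EReal.coe_ne_top _ h1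
  set r : Y := A xtil - b with hr
  have hAr : ContinuousLinearMap.adjoint A r = 0 := by rw [hr, map_sub, hfeas, sub_self]
  set ρ₀ : ℝ := (R xtil).toReal + F xtil with hρ₀
  have hsaddle : IsEpiSaddle (sumEpigraph R F) A (A xtil) ρ₀ xtil (A vtil) := by
    refine ⟨hepi xtil hxtil, rfl, fun p hp => ?_⟩
    have h1 := (hsub p.1).trans hp
    rw [← hreal xtil hxtil, ← EReal.coe_add, EReal.coe_le_coe_iff, inner_sub_left,
      inner_neg_left, ContinuousLinearMap.adjoint_inner_left, map_sub] at h1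
    have h2 := hFconv.add_inner_le_of_hasGradientAt (hFgrad xtil) p.1
    linarith
  have hpd : IsPDSequence (sumEpigraph R F) A (A xtil) τ σ x (fun k => y k - (k * σ) • r)
      (fun k => (R (x k)).toReal + F (x k)) := by
    have hdual' : ∀ k : ℕ, y (k + 1) - (((k + 1 : ℕ) : ℝ) * σ) • r
        = y k - ((k : ℝ) * σ) • r + σ • (A (x (k + 1)) - A xtil) := fun k => by
      rw [hdual k, hr]
      push_cast
      module
    refine ⟨convex_sumEpigraph hconv hFconv, isClosed_sumEpigraph hlsc hF, fun p hp t ht => ?_,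
      hτ, hσ, fun d => ?_, fun k => hepi _ (hxfin k), hdual', fun p hp v k => ?_⟩
    · refine le_trans hp (EReal.coe_le_coe_iff.2 ?_)
      dsimp only
      linarith
    · have : 0 ≤ L * ‖d‖ ^ 2 := by positivity
      linarith [hstep' d]
    · refine IsProx.gap_le hconv hFconv hFgrad hFlip hτ hσ hstep' ?_ (hreal _ (hxfin k)).symm
        (hdual' k) hp v
      convert hstep k using 3
      have h1 : y k = (if k = 0 then ym1 else y (k - 1)) + σ • (A (x k) - b) := by
        cases k with
        | zero => simpa using hinit
        | succ k => simpa using hdual k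
      have h2 : (2 : ℝ) • y k - (if k = 0 then ym1 else y (k - 1))
          = y k - ((k : ℝ) * σ) • r + σ • (A (x k) - A xtil) + ((k + 1 : ℝ) * σ) • r := by
        have h3 : (if k = 0 then ym1 else y (k - 1)) = y k - σ • (A (x k) - b) :=
          eq_sub_of_add_eq h1.symm
        rw [h3, hr]
        module
      rw [h2, map_add _ _ (((k + 1 : ℝ) * σ) • r), map_smul _ _ r, hAr, smul_zero, add_zero]
  have hmin : ∀ a : X, (a, ρ₀) ∈ sumEpigraph R F →
      (∀ p ∈ sumEpigraph R F, A p.1 = A xtil → ρ₀ ≤ p.2) →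
      ∀ u : X, A u = A xtil → R a + (F a : EReal) ≤ R u + (F u : EReal) := by
    intro a ha hle u hu
    by_cases hRu : R u = ⊤
    · simp [hRu]
    have h1 := hle (u, (R u).toReal + F u) (hepi u hRu) hu
    calc R a + (F a : EReal) ≤ ((ρ₀ - F a : ℝ) : EReal) + (F a : EReal) := by gcongr; exact ha
      _ = (ρ₀ : EReal) := by rw [← EReal.coe_add, sub_add_cancel]
      _ ≤ (((R u).toReal + F u : ℝ) : EReal) := EReal.coe_le_coe_iff.2 h1
      _ = R u + (F u : EReal) := by rw [EReal.coe_add, hreal u hRu]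
  have hle : ∀ {a d}, IsEpiSaddle (sumEpigraph R F) A (A xtil) ρ₀ a d →
      ∀ p ∈ sumEpigraph R F, A p.1 = A xtil → ρ₀ ≤ p.2 := fun h p hp hAp => by
    simpa [hAp] using h.le p hp
  refine ⟨?_, fun hno => ?_⟩
  · obtain ⟨a, d, hs, ha⟩ := hpd.exists_weakTendsto_runningAverage hsaddle
    exact ⟨a, (hnormal a).2 hs.feasible,
      fun u hu => hmin a hs.mem (hle hs) u ((hnormal u).1 hu), ha⟩
  · have hr0 : r ≠ 0 := fun h => hno ⟨xtil, sub_eq_zero.1 h, fun u hu =>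
      hmin xtil hsaddle.mem (hle hsaddle) u (by rw [hu, sub_eq_zero.1 h])⟩
    obtain ⟨C, hC⟩ := hpd.exists_norm_le hsaddle
    change Tendsto (fun k => ‖runningAverage y k‖) atTop atTop
    have hlow : ∀ k : ℕ, 1 ≤ k → (k : ℝ) * (σ / 2 * ‖r‖) - C ≤ ‖runningAverage y k‖ :=
      fun k hk => by
        have h1 := norm_runningAverage_le (u := fun j => y j - ((j : ℝ) * σ) • r)
          (fun j => (hC j).2) k
        have h2 : runningAverage y k = runningAverage (fun j => y j - ((j : ℝ) * σ) • r) k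
            + (((k : ℝ) + 1) / 2 * σ) • r := by
          have h6 : y = fun j => (y j - ((j : ℝ) * σ) • r)
              + (ContinuousLinearMap.toSpanSingleton ℝ (σ • r)) (j : ℝ) := by
            funext j
            simp [smul_smul]
          conv_lhs => rw [h6]
          rw [runningAverage_add, runningAverage_map, runningAverage_natCast hk]
          simp [smul_smul]
        have h3 : ‖(((k : ℝ) + 1) / 2 * σ) • r‖ = ((k : ℝ) + 1) / 2 * σ * ‖r‖ := by
          rw [norm_smul, Real.norm_of_nonneg (by positivity)]
        have h4 : 0 ≤ σ / 2 * ‖r‖ := by positivity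
        have h5 := norm_sub_le (runningAverage y k)
          (runningAverage (fun j => y j - ((j : ℝ) * σ) • r) k)
        rw [sub_eq_of_eq_add' h2, h3] at h5
        linarith
    have hlim : Tendsto (fun k : ℕ => (k : ℝ) * (σ / 2 * ‖r‖) - C) atTop atTop :=
      tendsto_atTop_add_const_right _ _
        (tendsto_natCast_atTop_atTop.atTop_mul_const (by positivity))
    exact tendsto_atTop_mono' _ ((eventually_ge_atTop 1).mono hlow) hlim
end
end

section
/- Assume there exists a saddle point (x̃, ṽ) ∈ X × X of the exact normal problem: −A*Aṽ − ∇F(x̃) ∈ ∂R(x̃) and A*Ax̃ = A*b*. Let 0 ≤ δ ≤ 1, let b^δ ∈ Y with ‖b^δ − b*‖ ≤ δ, and suppose there exists x^δ ∈ X with A*Ax^δ = A*b^δ. Suppose the stepsizes satisfy 1 − τ(L + σ‖A‖²) ≥ 0 and there exist ξ ∈ (0,1), η > 1 with ξ − τ(ξL + σ‖A‖²) ≥ 0 and σ(η − 1) − σξη > 0. Let (x_k, y_k) be generated by the scalar exact primal–dual algorithm with data b^δ and initialization y₀ = y₋₁ + σ(Ax₀ − b^δ), and let x̂_k = (1/k)∑_{j=1}^k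 x_j. Then there exist constants c₁,…,c₇ ≥ 0, independent of k and of δ, such that for every k ≥ 1: R(x̂_k) + F(x̂_k) − R(x̃) − F(x̃) + ⟨A*Aṽ, x̂_k − x̃⟩ ≤ c₁/k + c₂δ + c₃δ²k, and ‖A*Ax̂_k − A*b*‖² ≤ c₄/k + c₅δ + c₆δ²k + c₇δ². -/
open scoped RealInnerProductSpace ENNReal NNReal
open Filter Topology

noncomputable section

variable {X Y : Type*}
  [NormedAddCommGroup X] [InnerProductSpace ℝ X] [CompleteSpace X]
  [NormedAddCommGroup Y] [InnerProductSpace ℝ Y] [CompleteSpace Y]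

/-- Convexity of the real-valued part of `R` on its effective domain. -/
theorem ERealConvex.convexOn_toReal {E : Type*} [AddCommGroup E] [Module ℝ E] {R : E → EReal}
    (hR : ERealConvex R) (hbot : ∀ x, R x ≠ ⊥) :
    ConvexOn ℝ {x | R x ≠ ⊤} (fun x => (R x).toReal) := by
  have key : ∀ x, R x ≠ ⊤ → ∀ y, R y ≠ ⊤ → ∀ a b : ℝ, 0 ≤ a → 0 ≤ b → a + b = 1 →
      R (a • x + b • y) ≤ ((a * (R x).toReal + b * (R y).toReal : ℝ) : EReal) := by
    intro x hx y hy a b ha hb hab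
    obtain rfl : b = 1 - a := by linarith
    have h := hR x y a ha (by linarith)
    rw [← EReal.coe_toReal hx (hbot x), ← EReal.coe_toReal hy (hbot y)] at h
    exact_mod_cast h
  have hdom : ∀ x, R x ≠ ⊤ → ∀ y, R y ≠ ⊤ → ∀ a b : ℝ, 0 ≤ a → 0 ≤ b → a + b = 1 →
      R (a • x + b • y) ≠ ⊤ := fun x hx y hy a b ha hb hab =>
    ne_top_of_le_ne_top (EReal.coe_ne_top _) (key x hx y hy a b ha hb hab)
  refine ⟨fun x hx y hy a b ha hb hab => hdom x hx y hy a b ha hb hab,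
    fun x hx y hy a b ha hb hab => ?_⟩
  have h := key x hx y hy a b ha hb hab
  rw [← EReal.coe_toReal (hdom x hx y hy a b ha hb hab) (hbot _)] at h
  exact_mod_cast h

theorem IsProx.ne_top {E : Type*} [NormedAddCommGroup E] [InnerProductSpace ℝ E]
    {R : E → EReal} {τ : ℝ} {w p q : E} (hp : IsProx R τ w p) (hq : R q ≠ ⊤) : R p ≠ ⊤ := by
  intro h
  have h1 := hp q
  rw [h, EReal.top_add_coe, top_le_iff] at h1
  exact EReal.add_ne_top hq (EReal.coe_ne_top _) h1

/-- Variational inequality characterizing the proximal point. -/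
theorem IsProx.toReal_le {E : Type*} [NormedAddCommGroup E] [InnerProductSpace ℝ E]
    {R : E → EReal} (hR : ERealConvex R) (hbot : ∀ x, R x ≠ ⊥) {τ : ℝ} (hτ : 0 < τ) {w p q : E}
    (hp : IsProx R τ w p) (hq : R q ≠ ⊤) :
    (R p).toReal ≤ (R q).toReal + 1 / τ * ⟪w - p, p - q⟫ := by
  have hptop := hp.ne_top hq
  have hconv := hR.convexOn_toReal hbot
  refine le_of_forall_pos_le_add fun ε hε => ?_
  set C := 1 / (2 * τ) * ‖q - p‖ ^ 2 with hC
  have hC0 : 0 ≤ C := by positivity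
  obtain ⟨t, ht0, ht1, htε⟩ : ∃ t : ℝ, 0 < t ∧ t ≤ 1 ∧ t * C ≤ ε := by
    refine ⟨min 1 (ε / (C + 1)), by positivity, min_le_left _ _, ?_⟩
    calc min 1 (ε / (C + 1)) * C ≤ ε / (C + 1) * C := by gcongr; exact min_le_right _ _
      _ ≤ ε / (C + 1) * (C + 1) := by gcongr; linarith
      _ = ε := by field_simp
  have htop : R ((1 - t) • p + t • q) ≠ ⊤ :=
    hconv.1 hptop hq (by linarith) ht0.le (by ring)
  have h1 := hp ((1 - t) • p + t • q)
  rw [← EReal.coe_toReal hptop (hbot p), ← EReal.coe_toReal htop (hbot _)] at h1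
  have h2 : (R p).toReal + 1 / (2 * τ) * ‖p - w‖ ^ 2 ≤ (R ((1 - t) • p + t • q)).toReal
      + 1 / (2 * τ) * ‖(1 - t) • p + t • q - w‖ ^ 2 := by exact_mod_cast h1
  have h3 : (R ((1 - t) • p + t • q)).toReal ≤ (1 - t) * (R p).toReal + t * (R q).toReal :=
    hconv.2 hptop hq (by linarith) ht0.le (by ring)
  have h4 : (1 - t) • p + t • q - w = (p - w) + t • (q - p) := by module
  have h5 : ⟪w - p, p - q⟫ = ⟪p - w, q - p⟫ := by
    rw [← neg_sub p w, ← neg_sub q p, inner_neg_neg]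
  rw [h4, norm_add_sq_real, inner_smul_right, norm_smul, Real.norm_eq_abs, mul_pow, sq_abs] at h2
  rw [h5]
  have h6 : t * (R p).toReal ≤ t * ((R q).toReal + 1 / τ * ⟪p - w, q - p⟫ + t * C) := by
    have e : 1 / (2 * τ) * (‖p - w‖ ^ 2 + 2 * (t * ⟪p - w, q - p⟫) + t ^ 2 * ‖q - p‖ ^ 2)
        = 1 / (2 * τ) * ‖p - w‖ ^ 2 + t * (1 / τ * ⟪p - w, q - p⟫) + t * (t * C) := by
      rw [hC]; field_simp
    rw [e] at h2
    linarith
  have h7 := le_of_mul_le_mul_left h6 ht0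
  linarith

theorem HasGradientAt.hasDerivAt_add_smul {E : Type*} [NormedAddCommGroup E]
    [InnerProductSpace ℝ E] [CompleteSpace E] {F : E → ℝ} {u w g : E} {t : ℝ}
    (h : HasGradientAt F g (u + t • w)) :
    HasDerivAt (fun s : ℝ => F (u + s • w)) ⟪g, w⟫ t := by
  have h1 : HasDerivAt (fun s : ℝ => u + s • w) w t := by
    simpa using ((hasDerivAt_id t).smul_const w).const_add u
  have h2 := h.hasFDerivAt.comp_hasDerivAt t h1
  rwa [InnerProductSpace.toDual_apply_apply] at h2

theorem ConvexOn.add_inner_gradient_le {E : Type*} [NormedAddCommGroup E]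
    [InnerProductSpace ℝ E] [CompleteSpace E] {F : E → ℝ} (hF : ConvexOn ℝ Set.univ F)
    {u g : E} (h : HasGradientAt F g u) (v : E) : F u + ⟪g, v - u⟫ ≤ F v := by
  have hφ : ConvexOn ℝ Set.univ (fun s : ℝ => F (u + s • (v - u))) := by
    refine ⟨convex_univ, fun s _ t _ a b ha hb hab => ?_⟩
    have h1 : u + (a • s + b • t) • (v - u)
        = a • (u + s • (v - u)) + b • (u + t • (v - u)) := by
      have h2 : u = (a + b) • u := by rw [hab, one_smul]
      nth_rewrite 1 [h2]
      simp only [smul_eq_mul]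
      module
    simp only [h1]
    exact hF.2 trivial trivial ha hb hab
  have hd : HasDerivAt (fun s : ℝ => F (u + s • (v - u))) ⟪g, v - u⟫ 0 :=
    HasGradientAt.hasDerivAt_add_smul (by simpa using h)
  have h3 := hφ.le_slope_of_hasDerivAt (Set.mem_univ 0) (Set.mem_univ 1) one_pos hd
  simp only [slope_def_field, one_smul, zero_smul, add_zero, add_sub_cancel, sub_zero,
    div_one] at h3
  linarith

/-- The descent lemma for functions with Lipschitz gradient. -/
theorem le_add_inner_gradient_add_sq {E : Type*} [NormedAddCommGroup E]
    [InnerProductSpace ℝ E] [CompleteSpace E] {F : E → ℝ} {F' : E → E} {L : ℝ}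
    (hF : ∀ u, HasGradientAt F (F' u) u) (hL : ∀ u v, ‖F' u - F' v‖ ≤ L * ‖u - v‖) (u v : E) :
    F v ≤ F u + ⟪F' u, v - u⟫ + L / 2 * ‖v - u‖ ^ 2 := by
  set w := v - u with hw
  set f : ℝ → ℝ := fun t => F (u + t • w) - (t * ⟪F' u, w⟫ + L / 2 * ‖w‖ ^ 2 * t ^ 2) with hf
  have hd : ∀ t, HasDerivAt f
      (⟪F' (u + t • w), w⟫ - (1 * ⟪F' u, w⟫ + L / 2 * ‖w‖ ^ 2 * (2 * t))) t := by
    intro t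
    refine (hF _).hasDerivAt_add_smul.sub (((hasDerivAt_id t).mul_const _).add ?_)
    simpa using (hasDerivAt_pow 2 t).const_mul (L / 2 * ‖w‖ ^ 2)
  have hanti : AntitoneOn f (Set.Ici 0) := by
    refine antitoneOn_of_deriv_nonpos (convex_Ici 0)
      (fun t _ => (hd t).continuousAt.continuousWithinAt)
      (fun t _ => (hd t).differentiableAt.differentiableWithinAt) fun t ht => ?_
    rw [interior_Ici, Set.mem_Ioi] at ht
    rw [(hd t).deriv]
    have h1 : ⟪F' (u + t • w) - F' u, w⟫ ≤ L * (t * ‖w‖) * ‖w‖ := by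
      refine (real_inner_le_norm _ _).trans ?_
      gcongr
      refine (hL _ _).trans_eq ?_
      rw [add_sub_cancel_left, norm_smul, Real.norm_eq_abs, abs_of_pos ht]
    rw [inner_sub_left] at h1
    linarith
  have h01 := hanti (Set.mem_Ici.2 le_rfl) (Set.mem_Ici.2 zero_le_one) zero_le_one
  simp only [hf, one_smul, zero_smul, hw, add_sub_cancel, add_zero] at h01
  rw [← hw] at h01
  linarith

/-- A Gronwall-type estimate for perturbed Fejér sequences. -/
theorem add_sum_le_of_perturbed_decrease {Φ D u : ℕ → ℝ} {σ δ s : ℝ} (hσ : 0 < σ) (hδ : 0 ≤ δ)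
    (hs : 0 ≤ s) (hD : ∀ k, 0 ≤ D k) (hu : ∀ k, u k ^ 2 ≤ 2 * σ * Φ k)
    (h0 : 2 * σ * Φ 0 ≤ s ^ 2) (hstep : ∀ k, D (k + 1) + Φ (k + 1) ≤ Φ k + δ * u (k + 1))
    (k : ℕ) :
    2 * σ * (Φ k + ∑ j ∈ Finset.Icc 1 k, D j) ≤ (s + 2 * σ * δ * k) ^ 2 := by
  induction k with
  | zero => simpa using h0
  | succ k ih =>
    rw [Finset.sum_Icc_succ_top (by omega)]
    set S := ∑ j ∈ Finset.Icc 1 k, D j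
    have hS : 0 ≤ S := Finset.sum_nonneg fun j _ => hD j
    have ht : 0 ≤ 2 * σ * δ := by positivity
    have hB : 0 ≤ s + 2 * σ * δ * k := by positivity
    have hG : 2 * σ * (Φ (k + 1) + (S + D (k + 1)))
        ≤ 2 * σ * (Φ k + S) + 2 * σ * δ * u (k + 1) := by
      have := mul_le_mul_of_nonneg_left (hstep k) (by positivity : 0 ≤ 2 * σ)
      linarith
    have huG : u (k + 1) ^ 2 ≤ 2 * σ * (Φ (k + 1) + (S + D (k + 1))) := by
      have : 0 ≤ 2 * σ * (S + D (k + 1)) := mul_nonneg (by positivity) (add_nonneg hS (hD _))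
      linarith [hu (k + 1)]
    push_cast
    set B := s + 2 * σ * δ * k
    set t := 2 * σ * δ
    have hBt : s + t * (k + 1) = B + t := by simp only [B]; ring
    rw [hBt]
    have hub : u (k + 1) ≤ B + t := by
      by_contra! hlt
      nlinarith
    nlinarith [mul_le_mul_of_nonneg_left hub ht, mul_nonneg ht hB]

/-- One-step energy estimate of the primal–dual iteration, in error variables. -/
theorem primalDual_energy_step {E G : Type*} [NormedAddCommGroup E] [InnerProductSpace ℝ E]
    [NormedAddCommGroup G] [InnerProductSpace ℝ G] (A : E →L[ℝ] G) {τ σ L D : ℝ} (hτ : 0 < τ)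
    (hσ : 0 < σ) (hstep : 0 ≤ 1 - τ * (L + σ * ‖A‖ ^ 2)) (p q : E) (a b e : G)
    (hb : b = a + σ • (A q - e))
    (hD : D ≤ 1 / (2 * τ) * (‖p‖ ^ 2 - ‖q‖ ^ 2 - ‖q - p‖ ^ 2) + L / 2 * ‖q - p‖ ^ 2
      - ⟪b - σ • (A q - A p), A q⟫) :
    D + σ / 2 * ‖A q - e‖ ^ 2
        + (1 / (2 * τ) * ‖q‖ ^ 2 - σ / 2 * ‖A q‖ ^ 2 + 1 / (2 * σ) * ‖b‖ ^ 2)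
      ≤ 1 / (2 * τ) * ‖p‖ ^ 2 - σ / 2 * ‖A p‖ ^ 2 + 1 / (2 * σ) * ‖a‖ ^ 2 + ‖e‖ * ‖b‖ := by
  have h1 : ‖A q - A p‖ ^ 2 ≤ ‖A‖ ^ 2 * ‖q - p‖ ^ 2 := by
    rw [← map_sub, ← mul_pow]
    gcongr
    exact A.le_opNorm _
  have h2 : (L + σ * ‖A‖ ^ 2) / 2 * ‖q - p‖ ^ 2 ≤ 1 / (2 * τ) * ‖q - p‖ ^ 2 := by
    refine mul_le_mul_of_nonneg_right ?_ (sq_nonneg _)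
    rw [div_le_div_iff₀ two_pos (by positivity)]
    linarith
  have h3 : -⟪b, e⟫ ≤ ‖e‖ * ‖b‖ := by
    have := neg_le_of_abs_le (abs_real_inner_le_norm b e)
    linarith
  have h4 : 1 / (2 * σ) * ‖a‖ ^ 2
      = 1 / (2 * σ) * ‖b‖ ^ 2 - ⟪b, A q - e⟫ + σ / 2 * ‖A q - e‖ ^ 2 := by
    obtain rfl : a = b - σ • (A q - e) := by rw [hb]; abel
    rw [norm_sub_sq_real, inner_smul_right, norm_smul, Real.norm_eq_abs, mul_pow, sq_abs]
    field_simp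
  have h5 : ⟪b - σ • (A q - A p), A q⟫ = ⟪b, A q⟫ - σ * (‖A q‖ ^ 2 - ⟪A p, A q⟫) := by
    rw [inner_sub_left, real_inner_smul_left, inner_sub_left, real_inner_self_eq_norm_sq]
  have h6 : ‖A q - A p‖ ^ 2 = ‖A q‖ ^ 2 - 2 * ⟪A p, A q⟫ + ‖A p‖ ^ 2 := by
    rw [norm_sub_sq_real, real_inner_comm]
  rw [inner_sub_right] at h4
  rw [h5] at hD
  have h7 := mul_le_mul_of_nonneg_left h1 (by positivity : 0 ≤ σ / 2)
  rw [h6] at h7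
  linarith

theorem convexOn_norm_map_sub_sq {E G : Type*} [NormedAddCommGroup E] [NormedSpace ℝ E]
    [NormedAddCommGroup G] [NormedSpace ℝ G] (A : E →L[ℝ] G) (c : G) :
    ConvexOn ℝ Set.univ (fun x => ‖A x - c‖ ^ 2) := by
  have h : ConvexOn ℝ Set.univ (fun x => ‖A x - c‖) := by
    refine ⟨convex_univ, fun x _ y _ a b ha hb hab => ?_⟩
    have e : A (a • x + b • y) - c = a • (A x - c) + b • (A y - c) := by
      have h2 : c = (a + b) • c := by rw [hab, one_smul]
      nth_rewrite 1 [h2]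
      rw [map_add, map_smul, map_smul]
      module
    simp only [e]
    refine (norm_add_le _ _).trans_eq ?_
    rw [norm_smul_of_nonneg ha, norm_smul_of_nonneg hb, smul_eq_mul, smul_eq_mul]
  exact h.pow (fun x _ => norm_nonneg _) 2

/-- Stability with respect to a saddle point `(x̃, ṽ)` of the exact normal
problem: Bregman-gap and normal-feasibility bounds for the averaged primal iterates of the
scalar exact primal–dual algorithm run on noisy data, with constants independent of `k` and
of `δ`. -/
theorem statement_10
    (A : X →L[ℝ] Y) (bstar : Y)
    (R : X → EReal) (hR : ProperConvexLsc R)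
    (F : X → ℝ) (F' : X → X) (L : ℝ) (hL : 0 ≤ L)
    (hFconv : ConvexOn ℝ Set.univ F)
    (hFgrad : ∀ u : X, HasGradientAt F (F' u) u)
    (hFlip : ∀ u v : X, ‖F' u - F' v‖ ≤ L * ‖u - v‖)
    (τ σ : ℝ) (hτ : 0 < τ) (hσ : 0 < σ)
    (hstepsize : 0 ≤ 1 - τ * (L + σ * ‖A‖ ^ 2))
    (ξ η : ℝ) (hξ0 : 0 < ξ) (hξ1 : ξ < 1) (hη : 1 < η)
    (hθ : 0 ≤ ξ - τ * (ξ * L + σ * ‖A‖ ^ 2))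
    (hρ : 0 < σ * (η - 1) - σ * ξ * η)
    (xtil vtil : X)
    (hsubdiff : -(ContinuousLinearMap.adjoint A (A vtil)) - F' xtil ∈ epsSubdiff R 0 xtil)
    (hfeas : ContinuousLinearMap.adjoint A (A xtil) = ContinuousLinearMap.adjoint A bstar)
    (x₀ : X) (ym1 : Y) :
    ∃ c₁ c₂ c₃ c₄ c₅ c₆ c₇ : ℝ,
      0 ≤ c₁ ∧ 0 ≤ c₂ ∧ 0 ≤ c₃ ∧ 0 ≤ c₄ ∧ 0 ≤ c₅ ∧ 0 ≤ c₆ ∧ 0 ≤ c₇ ∧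
      ∀ δ : ℝ, 0 ≤ δ → δ ≤ 1 →
      ∀ bδ : Y, ‖bδ - bstar‖ ≤ δ →
      ∀ xδ : X, ContinuousLinearMap.adjoint A (A xδ) = ContinuousLinearMap.adjoint A bδ →
      ∀ x : ℕ → X, ∀ y : ℕ → Y,
        x 0 = x₀ →
        y 0 = ym1 + σ • (A x₀ - bδ) →
        (∀ k : ℕ,
          IsProx R τ
            (x k - τ • F' (x k)
              - τ • ContinuousLinearMap.adjoint A
                  ((2 : ℝ) • y k - (if k = 0 then ym1 else y (k - 1))))
            (x (k + 1))) →
        (∀ k : ℕ, y (k + 1) = y k + σ • (A (x (k + 1)) - bδ)) →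
        ∀ k : ℕ, 1 ≤ k →
          (R ((k : ℝ)⁻¹ • ∑ j ∈ Finset.Icc 1 k, x j)
              + ((F ((k : ℝ)⁻¹ • ∑ j ∈ Finset.Icc 1 k, x j) - F xtil
                  + ⟪ContinuousLinearMap.adjoint A (A vtil),
                      ((k : ℝ)⁻¹ • ∑ j ∈ Finset.Icc 1 k, x j) - xtil⟫ : ℝ) : EReal)
            ≤ R xtil + ((c₁ / k + c₂ * δ + c₃ * δ ^ 2 * k : ℝ) : EReal)) ∧
          ‖ContinuousLinearMap.adjoint A (A ((k : ℝ)⁻¹ • ∑ j ∈ Finset.Icc 1 k, x j))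
              - ContinuousLinearMap.adjoint A bstar‖ ^ 2
            ≤ c₄ / k + c₅ * δ + c₆ * δ ^ 2 * k + c₇ * δ ^ 2 := by
  obtain ⟨⟨xf, hxf⟩, hbot, hconv, -⟩ := hR
  have hxt : R xtil ≠ ⊤ := by
    intro h
    have h1 := hsubdiff xf
    rw [h, EReal.top_add_coe, top_le_iff] at h1
    exact hxf h1
  have hgap : ∀ u, R u ≠ ⊤ →
      0 ≤ (R u).toReal + F u - (R xtil).toReal - F xtil + ⟪A vtil, A (u - xtil)⟫ := by
    intro u hu
    have h1 := hsubdiff u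
    rw [← EReal.coe_toReal hxt (hbot _), ← EReal.coe_toReal hu (hbot _)] at h1
    have h2 : (R xtil).toReal + (⟪-(ContinuousLinearMap.adjoint A (A vtil)) - F' xtil, u - xtil⟫ - 0)
        ≤ (R u).toReal := by exact_mod_cast h1
    rw [inner_sub_left, inner_neg_left, ContinuousLinearMap.adjoint_inner_left] at h2
    linarith [hFconv.add_inner_gradient_le (hFgrad xtil) u]
  set S : ℝ := σ / τ * ‖x₀ - xtil‖ ^ 2 + (‖ym1 + σ • A (x₀ - xtil) - A vtil‖ + σ) ^ 2 with hS
  have hS0 : 0 ≤ S := by positivity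
  refine ⟨S / (2 * σ), 2 * √S, 2 * σ, ‖A‖ ^ 2 * (4 / σ) * (S / (2 * σ)),
    ‖A‖ ^ 2 * (4 / σ) * (2 * √S), ‖A‖ ^ 2 * (4 / σ) * (2 * σ), 2 * ‖A‖ ^ 2, by positivity,
    by positivity, by positivity, by positivity, by positivity, by positivity, by positivity, ?_⟩
  intro δ hδ0 hδ1 bδ hbδ xδ hxδ x y hx0 hy0 hprox hy k hk
  set e : Y := A (xδ - xtil) with he
  have heδ : ‖e‖ ≤ δ := by
    have h1 : ‖e‖ * ‖e‖ ≤ ‖e‖ * δ := by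
      have h2 : ⟪e, e⟫ = ⟪bδ - bstar, e⟫ := by
        rw [he, ← ContinuousLinearMap.adjoint_inner_left, ← ContinuousLinearMap.adjoint_inner_left,
          map_sub A, map_sub, map_sub, hxδ, hfeas]
      rw [← real_inner_self_eq_norm_mul_norm, h2, mul_comm]
      exact (real_inner_le_norm _ _).trans (by gcongr)
    by_contra! hlt
    nlinarith [hδ0.trans_lt hlt]
  set r : Y := bδ - A xδ with hr
  have hrA : ∀ w, ⟪r, A w⟫ = 0 := by
    intro w
    rw [← ContinuousLinearMap.adjoint_inner_left, hr, map_sub, hxδ, sub_self, inner_zero_left]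
  -- Dual error, corrected by the part of the datum that is invisible to the adjoint of `A`.
  set z : ℕ → Y := fun j => y j + ((j + 1 : ℝ) * σ) • r - A vtil with hz
  have hzsucc : ∀ j, z (j + 1) = z j + σ • (A (x (j + 1) - xtil) - e) := by
    intro j
    simp only [hz, hy, he, hr, map_sub]
    push_cast
    module
  have hytil : ∀ j, (2 : ℝ) • y j - (if j = 0 then ym1 else y (j - 1))
      = y j + σ • (A (x j) - bδ) := by
    rintro (_ | j)
    · simp only [if_true]
      rw [hx0, two_smul]
      nth_rewrite 2 [hy0]
      abel
    · simp only [Nat.succ_ne_zero, if_false, Nat.add_sub_cancel]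
      rw [two_smul]
      nth_rewrite 2 [hy j]
      abel
  have hxtop : ∀ j, R (x (j + 1)) ≠ ⊤ := fun j => (hprox j).ne_top hxf
  set f : X → ℝ := fun u => (R u).toReal + F u - (R xtil).toReal - F xtil
    + ⟪A vtil, A (u - xtil)⟫ + σ / 2 * ‖A (u - xtil) - e‖ ^ 2 with hf
  set Φ : ℕ → ℝ := fun j => 1 / (2 * τ) * ‖x j - xtil‖ ^ 2 - σ / 2 * ‖A (x j - xtil)‖ ^ 2
    + 1 / (2 * σ) * ‖z j‖ ^ 2 with hΦ
  have hstep : ∀ j, f (x (j + 1)) + Φ (j + 1) ≤ Φ j + δ * ‖z (j + 1)‖ := by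
    intro j
    have h1 := (hprox j).toReal_le hconv hbot hτ hxt
    rw [hytil] at h1
    have h2 := le_add_inner_gradient_add_sq hFgrad hFlip (x j) (x (j + 1))
    have h3 := hFconv.add_inner_gradient_le (hFgrad (x j)) xtil
    have h4 : 1 / τ * ⟪x j - τ • F' (x j) - τ • ContinuousLinearMap.adjoint A
          (y j + σ • (A (x j) - bδ)) - x (j + 1), x (j + 1) - xtil⟫
        = 1 / τ * ⟪x j - x (j + 1), x (j + 1) - xtil⟫ - ⟪F' (x j), x (j + 1) - xtil⟫
          - ⟪y j + σ • (A (x j) - bδ), A (x (j + 1) - xtil)⟫ := by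
      rw [← ContinuousLinearMap.adjoint_inner_left, sub_right_comm, sub_right_comm (x j),
        inner_sub_left, inner_sub_left, real_inner_smul_left, real_inner_smul_left]
      field_simp
    have h5 : ‖x j - xtil‖ ^ 2 = ‖x j - x (j + 1)‖ ^ 2
        + 2 * ⟪x j - x (j + 1), x (j + 1) - xtil⟫ + ‖x (j + 1) - xtil‖ ^ 2 := by
      rw [← norm_add_sq_real, sub_add_sub_cancel]
    have h6 : ⟪z (j + 1) - σ • (A (x (j + 1) - xtil) - A (x j - xtil)), A (x (j + 1) - xtil)⟫
        = ⟪y j + σ • (A (x j) - bδ), A (x (j + 1) - xtil)⟫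
          - ⟪A vtil, A (x (j + 1) - xtil)⟫ := by
      have : z (j + 1) - σ • (A (x (j + 1) - xtil) - A (x j - xtil))
          = y j + σ • (A (x j) - bδ) - A vtil + ((j + 2 : ℝ) * σ) • r := by
        simp only [hz, hy, map_sub]
        push_cast
        module
      rw [this, inner_add_left, real_inner_smul_left, hrA, inner_sub_left]
      ring
    have h7 : ⟪F' (x j), x (j + 1) - x j⟫ + ⟪F' (x j), x j - xtil⟫
        = ⟪F' (x j), x (j + 1) - xtil⟫ := by
      rw [← inner_add_right, sub_add_sub_cancel]
    have h8 : ⟪F' (x j), xtil - x j⟫ = -⟪F' (x j), x j - xtil⟫ := by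
      rw [← inner_neg_right, neg_sub]
    have h9 : x (j + 1) - xtil - (x j - xtil) = x (j + 1) - x j := by abel
    have h10 := primalDual_energy_step A (L := L)
      (D := (R (x (j + 1))).toReal + F (x (j + 1)) - (R xtil).toReal - F xtil
        + ⟪A vtil, A (x (j + 1) - xtil)⟫) hτ hσ hstepsize (x j - xtil) (x (j + 1) - xtil)
      (z j) (z (j + 1)) e (hzsucc j) (by
        rw [h6, h9, h5, norm_sub_rev (x j)]
        have : 1 / (2 * τ) * (‖x (j + 1) - x j‖ ^ 2
            + 2 * ⟪x j - x (j + 1), x (j + 1) - xtil⟫ + ‖x (j + 1) - xtil‖ ^ 2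
            - ‖x (j + 1) - xtil‖ ^ 2 - ‖x (j + 1) - x j‖ ^ 2)
            = 1 / τ * ⟪x j - x (j + 1), x (j + 1) - xtil⟫ := by
          field_simp
          ring
        rw [this]
        linarith)
    have h11 : ‖e‖ * ‖z (j + 1)‖ ≤ δ * ‖z (j + 1)‖ := by gcongr
    simp only [hf, hΦ]
    linarith
  have hΦz : ∀ j, ‖z j‖ ^ 2 ≤ 2 * σ * Φ j := by
    intro j
    have h1 : ‖A (x j - xtil)‖ ^ 2 ≤ ‖A‖ ^ 2 * ‖x j - xtil‖ ^ 2 := by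
      rw [← mul_pow]
      gcongr
      exact A.le_opNorm _
    have h2 : σ / 2 * ‖A‖ ^ 2 ≤ 1 / (2 * τ) := by
      rw [le_div_iff₀ (by positivity)]
      linarith [mul_nonneg hτ.le hL]
    have h3 : σ / 2 * ‖A (x j - xtil)‖ ^ 2 ≤ 1 / (2 * τ) * ‖x j - xtil‖ ^ 2 :=
      calc σ / 2 * ‖A (x j - xtil)‖ ^ 2 ≤ σ / 2 * (‖A‖ ^ 2 * ‖x j - xtil‖ ^ 2) := by gcongr
        _ = σ / 2 * ‖A‖ ^ 2 * ‖x j - xtil‖ ^ 2 := by ring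
        _ ≤ _ := by gcongr
    have h4 : 2 * σ * Φ j = 2 * σ * (1 / (2 * τ) * ‖x j - xtil‖ ^ 2
        - σ / 2 * ‖A (x j - xtil)‖ ^ 2) + ‖z j‖ ^ 2 := by
      simp only [hΦ]
      field_simp
    have h5 := mul_nonneg (by positivity : 0 ≤ 2 * σ) (sub_nonneg.2 h3)
    linarith
  have hΦ0 : 2 * σ * Φ 0 ≤ √S ^ 2 := by
    rw [Real.sq_sqrt hS0]
    have h1 : ‖z 0‖ ≤ ‖ym1 + σ • A (x₀ - xtil) - A vtil‖ + σ := by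
      have h2 : z 0 = (ym1 + σ • A (x₀ - xtil) - A vtil) - σ • e := by
        simp only [hz, hy0, he, hr, map_sub]
        push_cast
        module
      rw [h2]
      refine (norm_sub_le _ _).trans ?_
      rw [norm_smul_of_nonneg hσ.le]
      gcongr
      nlinarith
    have h2 : ‖z 0‖ ^ 2 ≤ (‖ym1 + σ • A (x₀ - xtil) - A vtil‖ + σ) ^ 2 := by gcongr
    have h3 : 2 * σ * Φ 0 = σ / τ * ‖x₀ - xtil‖ ^ 2 - σ ^ 2 * ‖A (x₀ - xtil)‖ ^ 2
        + ‖z 0‖ ^ 2 := by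
      simp only [hΦ, hx0]
      field_simp
    have h4 : 0 ≤ σ ^ 2 * ‖A (x₀ - xtil)‖ ^ 2 := by positivity
    linarith
  have hfgap : ∀ u, R u ≠ ⊤ → 0 ≤ f u := fun u hu =>
    add_nonneg (hgap u hu) (by positivity)
  have hkpos : (0 : ℝ) < k := by exact_mod_cast hk
  have hsum : ∑ j ∈ Finset.Icc 1 k, f (x j) ≤ (√S + 2 * σ * δ * k) ^ 2 / (2 * σ) := by
    have h1 := add_sum_le_of_perturbed_decrease (Φ := Φ)
      (D := fun j => if j = 0 then 0 else f (x j)) (u := fun j => ‖z j‖) hσ hδ0 (Real.sqrt_nonneg S)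
      (by
        rintro (_ | j)
        · simp
        · simpa using hfgap _ (hxtop j))
      hΦz hΦ0 (by simpa using hstep) k
    have h2 : ∑ j ∈ Finset.Icc 1 k, (if j = 0 then 0 else f (x j))
        = ∑ j ∈ Finset.Icc 1 k, f (x j) :=
      Finset.sum_congr rfl fun j hj => if_neg (by have := (Finset.mem_Icc.1 hj).1; omega)
    rw [h2] at h1
    rw [le_div_iff₀ (by positivity)]
    have h3 : 0 ≤ 2 * σ * Φ k := (sq_nonneg _).trans (hΦz k)
    linarith
  have hfconv : ConvexOn ℝ {u | R u ≠ ⊤} f := by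
    have hR' := hconv.convexOn_toReal hbot
    have hF1 := hFconv.subset (Set.subset_univ _) hR'.1
    have hlin : ConvexOn ℝ Set.univ fun u => ⟪A vtil, A u⟫ :=
      ((innerSL ℝ (A vtil)).comp A).toLinearMap.convexOn convex_univ
    have hsq := (convexOn_norm_map_sub_sq A (A xδ)).smul (by positivity : 0 ≤ σ / 2)
    have h := (((hR'.add hF1).add (hlin.subset (Set.subset_univ _) hR'.1)).add
      (hsq.subset (Set.subset_univ _) hR'.1)).add_const
        (-(R xtil).toReal - F xtil - ⟪A vtil, A xtil⟫)
    refine h.congr fun u _ => ?_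
    simp only [hf, he, Pi.add_apply, smul_eq_mul, map_sub, inner_sub_right, sub_sub_sub_cancel_right]
    ring
  set xhat := (k : ℝ)⁻¹ • ∑ j ∈ Finset.Icc 1 k, x j with hxhat
  have hmem : ∀ j ∈ Finset.Icc 1 k, x j ∈ {u | R u ≠ ⊤} := by
    intro j hj
    obtain ⟨i, rfl⟩ := Nat.exists_eq_add_of_le' (Finset.mem_Icc.1 hj).1
    exact hxtop i
  have hw : ∑ _j ∈ Finset.Icc 1 k, (k : ℝ)⁻¹ = 1 := by
    simp [hkpos.ne']
  have hhat : R xhat ≠ ⊤ := by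
    have := hfconv.1.sum_mem (fun _ _ => (inv_pos.2 hkpos).le) hw hmem
    rwa [← Finset.smul_sum] at this
  have hfhat : f xhat ≤ S / (2 * σ) / k + 2 * √S * δ + 2 * σ * δ ^ 2 * k := by
    have h1 := hfconv.map_sum_le (fun _ _ => (inv_pos.2 hkpos).le) hw hmem
    rw [← Finset.smul_sum, ← Finset.smul_sum] at h1
    calc f xhat ≤ (k : ℝ)⁻¹ * ∑ j ∈ Finset.Icc 1 k, f (x j) := h1
      _ ≤ (k : ℝ)⁻¹ * ((√S + 2 * σ * δ * k) ^ 2 / (2 * σ)) := by gcongr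
      _ = √S ^ 2 / (2 * σ) / k + 2 * √S * δ + 2 * σ * δ ^ 2 * k := by
        field_simp
        ring
      _ = _ := by rw [Real.sq_sqrt hS0]
  have hfdef : f xhat = (R xhat).toReal + F xhat - (R xtil).toReal - F xtil
    + ⟪A vtil, A (xhat - xtil)⟫ + σ / 2 * ‖A (xhat - xtil) - e‖ ^ 2 := rfl
  constructor
  · rw [← EReal.coe_toReal hhat (hbot _), ← EReal.coe_toReal hxt (hbot _),
      ContinuousLinearMap.adjoint_inner_left]
    have h1 : 0 ≤ σ / 2 * ‖A (xhat - xtil) - e‖ ^ 2 := by positivity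
    have h2 : (R xhat).toReal + (F xhat - F xtil + ⟪A vtil, A (xhat - xtil)⟫)
        ≤ (R xtil).toReal + (S / (2 * σ) / k + 2 * √S * δ + 2 * σ * δ ^ 2 * k) := by linarith
    exact_mod_cast h2
  · set B := S / (2 * σ) / k + 2 * √S * δ + 2 * σ * δ ^ 2 * k with hB
    have h1 : ‖A (xhat - xtil) - e‖ ^ 2 ≤ 2 / σ * B := by
      have : σ / 2 * ‖A (xhat - xtil) - e‖ ^ 2 ≤ B := by linarith [hgap xhat hhat]
      rw [div_mul_eq_mul_div, le_div_iff₀ hσ]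
      linarith
    have h2 : ‖A (xhat - xtil)‖ ^ 2 ≤ 2 * (2 / σ * B) + 2 * δ ^ 2 := by
      have h3 : ‖A (xhat - xtil)‖ ≤ ‖A (xhat - xtil) - e‖ + δ := by
        have := norm_add_le (A (xhat - xtil) - e) e
        rw [sub_add_cancel] at this
        linarith
      have h4 : ‖A (xhat - xtil)‖ ^ 2 ≤ (‖A (xhat - xtil) - e‖ + δ) ^ 2 := by gcongr
      linarith [sq_nonneg (‖A (xhat - xtil) - e‖ - δ)]
    rw [← hfeas, ← map_sub, ← map_sub]
    calc ‖ContinuousLinearMap.adjoint A (A (xhat - xtil))‖ ^ 2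
        ≤ (‖A‖ * ‖A (xhat - xtil)‖) ^ 2 := by
          gcongr
          refine ((ContinuousLinearMap.adjoint A).le_opNorm _).trans_eq ?_
          rw [LinearIsometryEquiv.norm_map]
      _ = ‖A‖ ^ 2 * ‖A (xhat - xtil)‖ ^ 2 := mul_pow _ _ _
      _ ≤ ‖A‖ ^ 2 * (2 * (2 / σ * B) + 2 * δ ^ 2) := by gcongr
      _ = _ := by rw [hB]; ring
end
end
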